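/- arXiv:2203.09140 — 2 statements merged into one kernel-verified Lean document; each statement's English description precedes it below -/
import Mathlib

section
/- Let n, m be positive integers, t ∈ ℝ, and let P : ℝ → M_n(ℂ) and x : ℝ → ℂⁿ be functions. Suppose A(t), Λ ∈ M_n(ℂ), B(t) ∈ M_{n×m}(ℂ), G(t) ∈ M_{m×n}(ℂ) are given, that P is differentiable at t with derivative A(t)P(t) − P(t)Λ − B(t)G(t), that P(t) is invertible, and that x is differentiable at t with derivative (A(t) − B(t)K(t))x(t), where K(t) := G(t)P(t)⁻¹. Then the function z : s ↦ P(s)⁻¹ x(s) is differentiable at t with derivative Λ z(t). -/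
open Matrix

attribute [local instance] Matrix.normedAddCommGroup Matrix.normedSpace

theorem Matrix.hasDerivAt_iff_entrywise {k l : Type*} [Fintype k] [Fintype l]
    {M : ℝ → Matrix k l ℂ} {M' : Matrix k l ℂ} {t : ℝ} :
    HasDerivAt M M' t ↔ ∀ i j, HasDerivAt (fun s => M s i j) (M' i j) t :=
  hasDerivAt_pi.trans (forall_congr' fun _ => hasDerivAt_pi)

theorem HasDerivAt.ringInverse {R : Type*} [NormedRing R] [NormedAlgebra ℝ R] [CompleteSpace R]
    {f : ℝ → R} {f' : R} {t : ℝ} (hf : HasDerivAt f f' t) (hunit : IsUnit (f t)) :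
    HasDerivAt (fun s => Ring.inverse (f s))
      (-(Ring.inverse (f t) * f' * Ring.inverse (f t))) t := by
  obtain ⟨u, hu⟩ := hunit
  have hinv := hasFDerivAt_ringInverse (𝕜 := ℝ) u
  rw [hu] at hinv
  simpa [Function.comp_def, ← hu] using hinv.comp_hasDerivAt t hf

theorem HasDerivAt.matrix_inv {k : Type*} [Fintype k] [DecidableEq k]
    {M : ℝ → Matrix k k ℂ} {M' : Matrix k k ℂ} {t : ℝ}
    (hM : HasDerivAt M M' t) (hunit : IsUnit (M t)) :
    HasDerivAt (fun s => (M s)⁻¹) (-((M t)⁻¹ * M' * (M t)⁻¹)) t := by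
  simp only [nonsing_inv_eq_ringInverse]
  -- The operator norm makes matrices a normed algebra and induces the same topology.
  exact @HasDerivAt.ringInverse _ Matrix.linftyOpNormedRing Matrix.linftyOpNormedAlgebra
    (inferInstanceAs (CompleteSpace (k → k → ℂ))) M M' t hM hunit

theorem HasDerivAt.matrix_mulVec {k l : Type*} [Fintype k] [Fintype l]
    {M : ℝ → Matrix k l ℂ} {M' : Matrix k l ℂ} {v : ℝ → l → ℂ} {v' : l → ℂ} {t : ℝ}
    (hM : HasDerivAt M M' t) (hv : HasDerivAt v v' t) :
    HasDerivAt (fun s => M s *ᵥ v s) (M' *ᵥ v t + M t *ᵥ v') t := by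
  rw [Matrix.hasDerivAt_iff_entrywise] at hM
  rw [hasDerivAt_pi] at hv ⊢
  intro i
  simp only [Pi.add_apply, mulVec, dotProduct, ← Finset.sum_add_distrib]
  exact HasDerivAt.fun_sum fun j _ => (hM i j).mul (hv j)

/-- If `P` solves the differential Sylvester equation `P'(t) = A P(t) − P(t) Λ − B G` at `t`,
`P(t)` is invertible, and `x` solves the closed-loop equation
`x'(t) = (A − B K(t)) x(t)` with `K(t) := G P(t)⁻¹`, then `z(s) := P(s)⁻¹ x(s)` is
differentiable at `t` with derivative `Λ z(t)`. -/
theorem closed_loop_transformed_to_LTI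
    (n m : ℕ) (hn : 0 < n) (hm : 0 < m)
    (P : ℝ → Matrix (Fin n) (Fin n) ℂ) (x : ℝ → Fin n → ℂ) (t : ℝ)
    (A Λ : Matrix (Fin n) (Fin n) ℂ)
    (B : Matrix (Fin n) (Fin m) ℂ) (G : Matrix (Fin m) (Fin n) ℂ)
    (hP : HasDerivAt P (A * P t - P t * Λ - B * G) t)
    (hinv : IsUnit (P t))
    (hx : HasDerivAt x ((A - B * (G * (P t)⁻¹)) *ᵥ x t) t) :
    HasDerivAt (fun s => (P s)⁻¹ *ᵥ x s) (Λ *ᵥ ((P t)⁻¹ *ᵥ x t)) t := by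
  have hdet : IsUnit (P t).det := (isUnit_iff_isUnit_det _).mp hinv
  convert (hP.matrix_inv hinv).matrix_mulVec hx using 1
  rw [mulVec_mulVec, mulVec_mulVec, ← add_mulVec]
  congr 1
  simp only [mul_sub, sub_mul, Matrix.mul_assoc, mul_nonsing_inv _ hdet,
    nonsing_inv_mul_cancel_left _ _ hdet, Matrix.mul_one]
  abel
end

section
/- Fix T > 0 and set ω := 2π/T. Let λ₁, λ₂ be distinct complex numbers and let t > 0. Then there exists δ > 0 such that for every square-summable double sequence (x_{1,k}, x_{2,k})_{k∈ℤ} ∈ ℓ²(ℤ,ℂ²), ∫₀^{t} ∑_{k∈ℤ} | x_{1,k} e^{(λ₁ + iωk)s} + x_{2,k} e^{(λ₂ + iωk)s} |² ds ≥ δ ∑_{k∈ℤ} ( |x_{1,k}|² + |x_{2,k}|² ). -/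
open MeasureTheory

/-- Two exponentials with distinct rates are separated at arbitrarily small positive times. -/
lemma exists_exp_mul_ne {l₁ l₂ : ℂ} (hl : l₁ ≠ l₂) {t : ℝ} (ht : 0 < t) :
    ∃ h : ℝ, 0 < h ∧ h < t ∧ Complex.exp (l₁ * h) ≠ Complex.exp (l₂ * h) := by
  have hn : 0 < ‖l₁ - l₂‖ := norm_pos_iff.2 (sub_ne_zero.2 hl)
  obtain ⟨h, h0, hlt⟩ := exists_between (lt_min ht (inv_pos.2 hn))
  refine ⟨h, h0, hlt.trans_le (min_le_left _ _), fun he => ?_⟩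
  have hz : ‖l₁ - l₂‖ * h < 1 := by
    have := mul_lt_mul_of_pos_left (hlt.trans_le (min_le_right _ _)) hn
    rwa [mul_inv_cancel₀ hn.ne'] at this
  obtain ⟨n, hn'⟩ := Complex.exp_eq_exp_iff_exists_int.1 he
  have hd : (l₁ - l₂) * h = n * (2 * Real.pi * Complex.I) := by linear_combination hn'
  have hnorm : ‖l₁ - l₂‖ * h = |(n : ℝ)| * (2 * Real.pi) := by
    have := congrArg norm hd
    simpa [abs_of_pos h0, abs_of_pos Real.pi_pos] using this
  rcases eq_or_ne n 0 with rfl | hn0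
  · simp only [Int.cast_zero, abs_zero, zero_mul] at hnorm
    exact (mul_pos hn h0).ne' hnorm
  · have h1 : (1 : ℝ) ≤ |(n : ℝ)| := by exact_mod_cast Int.one_le_abs hn0
    nlinarith [Real.pi_gt_three]

/-- The energy of a two-term exponential sum controls its first coefficient. The second
exponential is annihilated by the difference operator `u ↦ u (· + h) - exp (l₂ h) u`. -/
lemma exists_mul_norm_sq_le_integral_exp_add_exp {l₁ l₂ : ℂ} (hl : l₁ ≠ l₂) {t : ℝ}
    (ht : 0 < t) :
    ∃ δ : ℝ, 0 < δ ∧ ∀ a b : ℂ, δ * ‖a‖ ^ 2 ≤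
      ∫ s in (0 : ℝ)..t, ‖a * Complex.exp (l₁ * s) + b * Complex.exp (l₂ * s)‖ ^ 2 := by
  obtain ⟨h, h0, hht, hne⟩ := exists_exp_mul_ne hl ht
  set c := ‖Complex.exp (l₁ * h) - Complex.exp (l₂ * h)‖ ^ 2 with hc
  set K := ‖Complex.exp (l₂ * h)‖ ^ 2 with hK
  set m := ∫ s in (0 : ℝ)..(t - h), ‖Complex.exp (l₁ * s)‖ ^ 2 with hm
  have hc0 : 0 < c := pow_pos (norm_pos_iff.2 (sub_ne_zero.2 hne)) 2
  have hK0 : 0 ≤ K := by positivity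
  have hm0 : 0 < m := by
    refine intervalIntegral.intervalIntegral_pos_of_pos
      (Continuous.intervalIntegrable (by fun_prop) _ _) (fun s => ?_) (by linarith)
    exact pow_pos (norm_pos_iff.2 (Complex.exp_ne_zero _)) 2
  refine ⟨c * m / (2 + 2 * K), by positivity, fun a b => ?_⟩
  set f : ℝ → ℝ := fun s => ‖a * Complex.exp (l₁ * s) + b * Complex.exp (l₂ * s)‖ ^ 2 with hf
  have hfc : Continuous f := by fun_prop
  have hfi : ∀ u v : ℝ, IntervalIntegrable f volume u v := fun u v => hfc.intervalIntegrable u v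
  have hf0 : ∀ s, 0 ≤ f s := fun s => by positivity
  have hpt : ∀ s : ℝ, c * ‖a‖ ^ 2 * ‖Complex.exp (l₁ * s)‖ ^ 2 ≤ 2 * f (s + h) + 2 * K * f s := by
    intro s
    have hid : (Complex.exp (l₁ * h) - Complex.exp (l₂ * h)) * a * Complex.exp (l₁ * s) =
        (a * Complex.exp (l₁ * (s + h : ℝ)) + b * Complex.exp (l₂ * (s + h : ℝ))) -
          Complex.exp (l₂ * h) * (a * Complex.exp (l₁ * s) + b * Complex.exp (l₂ * s)) := by
      push_cast
      rw [mul_add, mul_add, Complex.exp_add, Complex.exp_add]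
      ring
    have hle := norm_sub_le
      (a * Complex.exp (l₁ * (s + h : ℝ)) + b * Complex.exp (l₂ * (s + h : ℝ)))
      (Complex.exp (l₂ * h) * (a * Complex.exp (l₁ * s) + b * Complex.exp (l₂ * s)))
    rw [← hid, norm_mul, norm_mul, norm_mul (Complex.exp (l₂ * h))] at hle
    have hsq := (pow_le_pow_left₀ (by positivity) hle 2).trans (add_sq_le (R := ℝ))
    simp only [hf, hc, hK]
    linear_combination hsq
  have hshift : ∫ s in (0 : ℝ)..(t - h), f (s + h) ≤ ∫ s in (0 : ℝ)..t, f s := by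
    rw [intervalIntegral.integral_comp_add_right, zero_add, sub_add_cancel]
    exact intervalIntegral.integral_mono_interval h0.le hht.le le_rfl
      (Filter.Eventually.of_forall hf0) (hfi _ _)
  have hinit : ∫ s in (0 : ℝ)..(t - h), f s ≤ ∫ s in (0 : ℝ)..t, f s :=
    intervalIntegral.integral_mono_interval le_rfl (by linarith) (by linarith)
      (Filter.Eventually.of_forall hf0) (hfi _ _)
  have hint : c * ‖a‖ ^ 2 * m ≤
      2 * (∫ s in (0 : ℝ)..(t - h), f (s + h)) + 2 * K * ∫ s in (0 : ℝ)..(t - h), f s := by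
    rw [hm, ← intervalIntegral.integral_const_mul, ← intervalIntegral.integral_const_mul,
      ← intervalIntegral.integral_const_mul, ← intervalIntegral.integral_add]
    · exact intervalIntegral.integral_mono_on (by linarith)
        (Continuous.intervalIntegrable (by fun_prop) _ _)
        (Continuous.intervalIntegrable (by fun_prop) _ _) fun s _ => hpt s
    · exact Continuous.intervalIntegrable (by fun_prop) _ _
    · exact Continuous.intervalIntegrable (by fun_prop) _ _
  have hKinit := mul_le_mul_of_nonneg_left hinit hK0
  rw [div_mul_eq_mul_div, div_le_iff₀ (by positivity)]
  linarith

/-- A common imaginary shift of the two rates does not change the modulus. -/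
lemma norm_exp_add_exp_imaginary_shift (a b l₁ l₂ : ℂ) (r s : ℝ) :
    ‖a * Complex.exp ((l₁ + Complex.I * r) * s) + b * Complex.exp ((l₂ + Complex.I * r) * s)‖ =
      ‖a * Complex.exp (l₁ * s) + b * Complex.exp (l₂ * s)‖ := by
  have hfac : a * Complex.exp ((l₁ + Complex.I * r) * s) +
      b * Complex.exp ((l₂ + Complex.I * r) * s) =
      (a * Complex.exp (l₁ * s) + b * Complex.exp (l₂ * s)) *
        Complex.exp ((r * s : ℝ) * Complex.I) := by
    rw [add_mul, add_mul, Complex.exp_add, Complex.exp_add]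
    push_cast
    ring_nf
  rw [hfac, norm_mul, Complex.norm_exp_ofReal_mul_I, mul_one]

/-- The energy of a square-summable family of two-term exponential sums is the sum of the
individual energies. -/
lemma hasSum_integral_exp_add_exp (l₁ l₂ : ℂ) (t : ℝ) {ι : Type*} [Countable ι]
    {x₁ x₂ : ι → ℂ} (h₁ : Summable fun k => ‖x₁ k‖ ^ 2) (h₂ : Summable fun k => ‖x₂ k‖ ^ 2) :
    HasSum
      (fun k => ∫ s in (0 : ℝ)..t,
        ‖x₁ k * Complex.exp (l₁ * s) + x₂ k * Complex.exp (l₂ * s)‖ ^ 2)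
      (∫ s in (0 : ℝ)..t, ∑' k,
        ‖x₁ k * Complex.exp (l₁ * s) + x₂ k * Complex.exp (l₂ * s)‖ ^ 2) := by
  set g : ι → ℝ → ℝ := fun k s => 2 * (‖x₁ k‖ ^ 2 * ‖Complex.exp (l₁ * s)‖ ^ 2 +
    ‖x₂ k‖ ^ 2 * ‖Complex.exp (l₂ * s)‖ ^ 2) with hg
  have hle : ∀ (k : ι) (s : ℝ),
      ‖x₁ k * Complex.exp (l₁ * s) + x₂ k * Complex.exp (l₂ * s)‖ ^ 2 ≤ g k s := by
    intro k s
    have hadd := norm_add_le (x₁ k * Complex.exp (l₁ * s)) (x₂ k * Complex.exp (l₂ * s))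
    rw [norm_mul, norm_mul] at hadd
    have hsq := (pow_le_pow_left₀ (norm_nonneg _) hadd 2).trans (add_sq_le (R := ℝ))
    simpa only [hg, mul_pow] using hsq
  have hgs : ∀ s, Summable fun k => g k s := fun s =>
    ((h₁.mul_right _).add (h₂.mul_right _)).mul_left 2
  have hgt : (fun s => ∑' k, g k s) = fun s : ℝ =>
      2 * ((∑' k, ‖x₁ k‖ ^ 2) * ‖Complex.exp (l₁ * s)‖ ^ 2 +
        (∑' k, ‖x₂ k‖ ^ 2) * ‖Complex.exp (l₂ * s)‖ ^ 2) := by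
    funext s
    simp only [hg]
    rw [tsum_mul_left, (h₁.mul_right _).tsum_add (h₂.mul_right _), tsum_mul_right, tsum_mul_right]
  refine intervalIntegral.hasSum_integral_of_dominated_convergence g (fun k => ?_)
    (fun k => Filter.Eventually.of_forall fun s _ => ?_)
    (Filter.Eventually.of_forall fun s _ => hgs s) ?_
    (Filter.Eventually.of_forall fun s _ => ?_)
  · exact Continuous.aestronglyMeasurable (by fun_prop)
  · rw [Real.norm_of_nonneg (by positivity)]
    exact hle k s
  · rw [hgt]
    exact Continuous.intervalIntegrable (by fun_prop) _ _
  · exact (Summable.of_nonneg_of_le (fun k => by positivity) (fun k => hle k s) (hgs s)).hasSum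

lemma Memℓp.summable_norm_sq {ι : Type*} {x : ι → ℂ} (hx : Memℓp x 2) :
    Summable fun k => ‖x k‖ ^ 2 := by
  simpa using hx.summable (by norm_num)

/-- Exact observability of the pair `([1 1], Λ⊗I − 𝒩)` with `Λ = diag(l₁,l₂)`, `l₁ ≠ l₂`:
there is `δ > 0` such that for every square-summable double sequence
`(x_{1,k}, x_{2,k})_{k∈ℤ}`,
`∫₀ᵗ ∑_k |x_{1,k} e^{(l₁+iωk)s} + x_{2,k} e^{(l₂+iωk)s}|² ds ≥ δ ∑_k (|x_{1,k}|²+|x_{2,k}|²)`. -/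
theorem exact_observability_counterexample_pair
    (T ω : ℝ) (hT : 0 < T) (hω : ω = 2 * Real.pi / T)
    (l₁ l₂ : ℂ) (hl : l₁ ≠ l₂) (t : ℝ) (ht : 0 < t) :
    ∃ δ : ℝ, 0 < δ ∧
      ∀ x₁ x₂ : ℤ → ℂ, Memℓp x₁ 2 → Memℓp x₂ 2 →
        δ * ((∑' k : ℤ, ‖x₁ k‖ ^ 2) + ∑' k : ℤ, ‖x₂ k‖ ^ 2) ≤
          ∫ s in (0:ℝ)..t, ∑' k : ℤ,
            ‖x₁ k * Complex.exp ((l₁ + Complex.I * ω * k) * s) +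
              x₂ k * Complex.exp ((l₂ + Complex.I * ω * k) * s)‖ ^ 2 := by
  obtain ⟨δ₁, hδ₁, hb₁⟩ := exists_mul_norm_sq_le_integral_exp_add_exp hl ht
  obtain ⟨δ₂, hδ₂, hb₂⟩ := exists_mul_norm_sq_le_integral_exp_add_exp hl.symm ht
  refine ⟨min δ₁ δ₂ / 2, by positivity, fun x₁ x₂ hx₁ hx₂ => ?_⟩
  have h₁ := hx₁.summable_norm_sq
  have h₂ := hx₂.summable_norm_sq
  have hshift : ∀ (k : ℤ) (s : ℝ),
      ‖x₁ k * Complex.exp ((l₁ + Complex.I * ω * k) * s) +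
        x₂ k * Complex.exp ((l₂ + Complex.I * ω * k) * s)‖ =
      ‖x₁ k * Complex.exp (l₁ * s) + x₂ k * Complex.exp (l₂ * s)‖ := fun k s => by
    rw [← norm_exp_add_exp_imaginary_shift _ _ l₁ l₂ (ω * k) s]
    push_cast
    simp only [mul_assoc]
  simp only [hshift]
  have hsum := hasSum_integral_exp_add_exp l₁ l₂ t h₁ h₂
  refine hasSum_le (fun k => ?_) ((h₁.hasSum.add h₂.hasSum).mul_left (min δ₁ δ₂ / 2)) hsum
  have hk₁ := hb₁ (x₁ k) (x₂ k)
  have hk₂ := hb₂ (x₂ k) (x₁ k)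
  simp only [add_comm (x₂ k * _)] at hk₂
  have hm₁ := mul_le_mul_of_nonneg_right (min_le_left δ₁ δ₂) (sq_nonneg ‖x₁ k‖)
  have hm₂ := mul_le_mul_of_nonneg_right (min_le_right δ₁ δ₂) (sq_nonneg ‖x₂ k‖)
  linarith
end
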